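/- arXiv:2301.06467 — 2 statements merged into one kernel-verified Lean document; each statement's English description precedes it below -/
import Mathlib

section
/- Let (X,d) be a metric space whose Nagata dimension is at most n ∈ ℕ∪{0} with Nagata constant c, and let ε ∈ (0,1). Then there exists a Lipschitz light map f from the snowflake (X,d^ε) into ℝ^n, whose Lipschitz light constant can be chosen to depend only on n, ε, and c. -/
open Metric Set
open scoped ENNReal NNReal

/-- `l` is an `r`-path (consecutive distances at most `r`) lying in the set `S`. -/
def IsRPathIn {X : Type*} [PseudoMetricSpace X] (r : ℝ) (S : Set X) (l : List X) : Prop :=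
  (∀ z ∈ l, z ∈ S) ∧ l.Chain' (fun a b => dist a b ≤ r)

/-- `x` and `y` lie in the same `r`-component of `S`: they are joined by an `r`-path in `S`. -/
def SameRComponent {X : Type*} [PseudoMetricSpace X] (r : ℝ) (S : Set X) (x y : X) : Prop :=
  ∃ l : List X, IsRPathIn r S l ∧ l.head? = some x ∧ l.getLast? = some y

/-- `f` is Lipschitz light with constant `C`: it is `C`-Lipschitz and, for every `r > 0` and
every `W ⊆ Y` with `diam W ≤ r`, every `r`-component of `f ⁻¹' W` has diameter at most `C * r`. -/
def LipschitzLightWith {X Y : Type*} [PseudoMetricSpace X] [PseudoMetricSpace Y]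
    (C : ℝ) (f : X → Y) : Prop :=
  (∀ x y : X, dist (f x) (f y) ≤ C * dist x y) ∧
  ∀ r : ℝ, 0 < r → ∀ W : Set Y, EMetric.diam W ≤ ENNReal.ofReal r →
    ∀ x y : X, SameRComponent r (f ⁻¹' W) x y → dist x y ≤ C * r

/-- `X` has Nagata dimension at most `n` with constant `c`: for every `s > 0` there is a
`c*s`-bounded covering of `X` with `s`-multiplicity at most `n + 1`. -/
def NagataWith (X : Type*) [PseudoMetricSpace X] (n : ℕ) (c : ℝ) : Prop :=
  ∀ s : ℝ, 0 < s → ∃ 𝓑 : Set (Set X), (⋃₀ 𝓑 = univ) ∧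
    (∀ B ∈ 𝓑, EMetric.diam B ≤ ENNReal.ofReal (c * s)) ∧
    ∀ E : Set X, EMetric.diam E ≤ ENNReal.ofReal s →
      {B ∈ 𝓑 | (B ∩ E).Nonempty}.encard ≤ (n + 1 : ℕ)

/-- The snowflake metric space `(X, d^ε)`. -/
noncomputable def Snowflake {X : Type*} (m : MetricSpace X) {ε : ℝ}
    (h0 : 0 < ε) (h1 : ε ≤ 1) : MetricSpace X :=
  letI := m
  { dist := fun x y => dist x y ^ ε
    dist_self := fun x => by simp [Real.zero_rpow h0.ne']
    dist_comm := fun x y => by simp only [dist_comm]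
    dist_triangle := fun x y z => by
      calc dist x z ^ ε ≤ (dist x y + dist y z) ^ ε :=
            Real.rpow_le_rpow dist_nonneg (dist_triangle x y z) h0.le
        _ ≤ dist x y ^ ε + dist y z ^ ε := by
            have h := NNReal.rpow_add_le_add_rpow (Real.toNNReal (dist x y))
              (Real.toNNReal (dist y z)) h0.le h1
            have h2 : ((Real.toNNReal (dist x y) + Real.toNNReal (dist y z) : ℝ≥0) : ℝ) ^ ε
                ≤ ((Real.toNNReal (dist x y) : ℝ)) ^ ε + ((Real.toNNReal (dist y z) : ℝ)) ^ ε := by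
              exact_mod_cast h
            simpa [Real.coe_toNNReal _ dist_nonneg] using h2
    eq_of_dist_eq_zero := fun {x y} h => by
      have : dist x y = 0 := (Real.rpow_eq_zero dist_nonneg h0.ne').mp h
      exact eq_of_dist_eq_zero this }

/-- A space of Nagata dimension at most `n` splits, at every scale `σ`, into `n + 1` sets whose
`σ`-components have diameter at most a fixed multiple of `σ`. -/
theorem NagataWith.exists_cover {X : Type*} [PseudoMetricSpace X] {n : ℕ} {c : ℝ} (hc : 0 < c)
    (h : NagataWith X n c) {σ : ℝ} (hσ : 0 < σ) :
    ∃ A : Fin (n + 1) → Set X, (∀ x, ∃ i, x ∈ A i) ∧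
      ∀ (i : Fin (n + 1)) (p : ℕ → X) (N : ℕ), (∀ m ≤ N, p m ∈ A i) →
        (∀ m < N, dist (p m) (p (m + 1)) ≤ σ) →
        dist (p 0) (p N) ≤ 4 * (n + 1) * (c + 1) * σ := by
  obtain ⟨𝓑, hcov, hdiam, hmult⟩ := h (4 * (n + 1) * σ) (by positivity)
  have hcov' : ∀ x, ∃ B ∈ 𝓑, x ∈ B := fun x => by
    have hx : x ∈ ⋃₀ 𝓑 := hcov ▸ mem_univ x
    simpa using hx
  refine ⟨fun i => {x | ∀ B ∈ 𝓑, B.Nonempty → 2 * σ * i < infDist x B →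
    2 * σ * (i + 1) ≤ infDist x B}, fun x => ?_, fun i p N hp hstep => ?_⟩
  · by_contra! hcon
    simp only [mem_ofPred_eq, not_forall, not_le] at hcon
    choose B hB hne hlo hhi using hcon
    obtain ⟨B₀, hB₀, hx₀⟩ := hcov' x
    let F : Option (Fin (n + 1)) → Set X := fun o => o.elim B₀ B
    have hlt : ∀ i j : Fin (n + 1), i < j → B i ≠ B j := fun i j hij heq => by
      have h1 := hhi i
      have h2 := hlo j
      rw [heq] at h1
      have h3 : ((i : ℕ) : ℝ) + 1 ≤ (j : ℕ) := by exact_mod_cast hij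
      have h4 : 2 * σ * (((i : ℕ) : ℝ) + 1) ≤ 2 * σ * (j : ℕ) := by gcongr
      linarith
    have h0 : ∀ i, B₀ ≠ B i := fun i heq => by
      have h1 := hlo i
      rw [← heq, infDist_zero_of_mem hx₀] at h1
      have : 0 ≤ 2 * σ * ((i : ℕ) : ℝ) := by positivity
      linarith
    have hF : Function.Injective F := by
      rintro (_ | i) (_ | j) hij
      · rfl
      · exact (h0 j hij).elim
      · exact (h0 i hij.symm).elim
      · rcases lt_trichotomy i j with hl | hl | hl
        · exact (hlt i j hl hij).elim
        · rw [hl]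
        · exact (hlt j i hl hij.symm).elim
    have hsub : range F ⊆ {B ∈ 𝓑 | (B ∩ ball x (2 * (n + 1) * σ)).Nonempty} := by
      rintro _ ⟨_ | i, rfl⟩
      · exact ⟨hB₀, x, hx₀, mem_ball_self (by positivity)⟩
      · refine ⟨hB i, ?_⟩
        have h1 : infDist x (B i) < 2 * (n + 1) * σ := by
          have h3 : ((i : ℕ) : ℝ) + 1 ≤ n + 1 := by exact_mod_cast i.2
          have h4 : 2 * σ * (((i : ℕ) : ℝ) + 1) ≤ 2 * σ * (n + 1) := by gcongr
          linarith [hhi i]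
        obtain ⟨b, hb, hxb⟩ := (infDist_lt_iff (hne i)).1 h1
        exact ⟨b, hb, by rwa [mem_ball']⟩
    have hball : Metric.ediam (ball x (2 * (n + 1) * σ)) ≤ ENNReal.ofReal (4 * (n + 1) * σ) := by
      refine Metric.ediam_le fun y hy z hz => ?_
      rw [edist_dist]
      refine ENNReal.ofReal_le_ofReal ?_
      rw [mem_ball] at hy hz
      linarith [dist_triangle_right y z x]
    have hcard := (encard_le_encard hsub).trans (hmult _ hball)
    rw [← image_univ, hF.encard_image, encard_univ] at hcard
    simp only [ENat.card_eq_coe_fintype_card, Fintype.card_option, Fintype.card_fin] at hcard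
    norm_cast at hcard
    omega
  · obtain ⟨B, hB, hpB⟩ := hcov' (p 0)
    have hne : B.Nonempty := ⟨_, hpB⟩
    have key : ∀ m ≤ N, infDist (p m) B ≤ 2 * σ * (i : ℕ) := by
      intro m
      induction m with
      | zero =>
        intro _
        rw [infDist_zero_of_mem hpB]
        positivity
      | succ m ih =>
        intro hm
        by_contra! hcon
        have h1 := hp (m + 1) hm B hB hne hcon
        have h2 := ih (by omega)
        have h3 := hstep m (by omega)
        have h4 := infDist_le_infDist_add_dist (s := B) (x := p (m + 1)) (y := p m)
        rw [dist_comm] at h4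
        linarith
    have h1 : infDist (p N) B < 2 * σ * (n + 1) := by
      have h3 : ((i : ℕ) : ℝ) < n + 1 := by exact_mod_cast i.2
      exact (key N le_rfl).trans_lt (by gcongr)
    obtain ⟨b, hb, hxb⟩ := (infDist_lt_iff hne).1 h1
    have h2 : dist (p 0) b ≤ c * (4 * (n + 1) * σ) := by
      have h := (Metric.edist_le_ediam_of_mem hpB hb).trans (hdiam B hB)
      rwa [edist_dist, ENNReal.ofReal_le_ofReal_iff (by positivity)] at h
    have h3 : 0 ≤ 2 * σ * (n + 1) := by positivity
    linarith [dist_triangle_right (p 0) (p N) b]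

/-- A Lipschitz function with values in `[0, 1]` vanishing on `A` and equal to `1` away from the
`σ`-neighbourhood of `A`. -/
theorem exists_lipschitz_separating {X : Type*} [PseudoMetricSpace X] (A : Set X) {σ : ℝ}
    (hσ : 0 < σ) :
    ∃ h : X → ℝ, (∀ x, 0 ≤ h x) ∧ (∀ x, h x ≤ 1) ∧ (∀ x y, |h x - h y| ≤ dist x y / σ) ∧
      (∀ x, h x < 1 → ∃ a ∈ A, dist x a < σ) ∧ ∀ x ∈ A, h x = 0 := by
  rcases A.eq_empty_or_nonempty with rfl | hA
  · exact ⟨fun _ => 1, by simp, by simp, fun x y => by simp; positivity, by simp, by simp⟩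
  refine ⟨fun x => min 1 (infDist x A / σ), fun x => ?_, fun x => min_le_left _ _, fun x y => ?_,
    fun x hx => ?_, fun x hx => by simp [infDist_zero_of_mem hx]⟩
  · exact le_min zero_le_one (div_nonneg infDist_nonneg hσ.le)
  · refine (abs_min_sub_min_le_max _ _ _ _).trans ?_
    rw [sub_self, abs_zero, max_eq_right (abs_nonneg _), ← sub_div, abs_div, abs_of_pos hσ]
    gcongr
    rw [← Real.dist_eq]
    simpa using (lipschitz_infDist_pt A).dist_le_mul x y
  · have h1 : infDist x A / σ < 1 := by
      by_contra! h
      simp [h] at hx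
    rw [div_lt_one hσ] at h1
    exact (infDist_lt_iff hA).1 h1

/-- The one-scale map: a `σ⁻¹`-Lipschitz map to the unit cube of `ℝⁿ` along which a `σ`-path
with almost constant image stays within a fixed multiple of `σ` of its starting point. -/
theorem NagataWith.exists_map_cube {X : Type*} [PseudoMetricSpace X] {n : ℕ} {c : ℝ} (hc : 0 < c)
    (h : NagataWith X n c) {σ : ℝ} (hσ : 0 < σ) :
    ∃ h : Fin n → X → ℝ, (∀ i x, 0 ≤ h i x) ∧ (∀ i x, h i x ≤ 1) ∧
      (∀ i x y, |h i x - h i y| ≤ dist x y / σ) ∧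
      ∀ (p : ℕ → X) (N : ℕ), (∀ m < N, dist (p m) (p (m + 1)) ≤ σ) →
        (∀ m ≤ N, ∀ i, |h i (p m) - h i (p 0)| < 1 / 2) →
        dist (p 0) (p N) ≤ (12 * (n + 1) * (c + 1) + 2) * σ := by
  obtain ⟨A, hcov, hA⟩ := h.exists_cover hc (σ := 3 * σ) (by positivity)
  choose h h0 h1 hlip hnear hzero using fun i : Fin n => exists_lipschitz_separating (A i.succ) hσ
  refine ⟨h, h0, h1, hlip, fun p N hstep hp => ?_⟩
  by_cases hsmall : ∃ i, h i (p 0) < 1 / 2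
  · obtain ⟨i, hi⟩ := hsmall
    have hq : ∀ m, ∃ a, m ≤ N → a ∈ A i.succ ∧ dist (p m) a < σ := fun m => by
      by_cases hm : m ≤ N
      · obtain ⟨a, ha, hd⟩ := hnear i (p m) (by linarith [(abs_lt.1 (hp m hm i)).2])
        exact ⟨a, fun _ => ⟨ha, hd⟩⟩
      · exact ⟨p 0, fun h => (hm h).elim⟩
    choose q hq using hq
    have hqN := hA i.succ q N (fun m hm => (hq m hm).1) fun m hm => by
      have h1 := (hq m hm.le).2
      have h2 := (hq (m + 1) hm).2
      have h3 := hstep m hm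
      have h4 := dist_triangle4 (q m) (p m) (p (m + 1)) (q (m + 1))
      rw [dist_comm (q m) (p m)] at h4
      linarith
    have h1 := (hq 0 (Nat.zero_le _)).2
    have h2 := (hq N le_rfl).2
    have h3 := dist_triangle4 (p 0) (q 0) (q N) (p N)
    rw [dist_comm (q N) (p N)] at h3
    linarith
  · push Not at hsmall
    have hmem : ∀ m ≤ N, p m ∈ A 0 := fun m hm => by
      obtain ⟨i, hi⟩ := hcov (p m)
      induction i using Fin.cases with
      | zero => exact hi
      | succ i =>
        have h1 := (abs_lt.1 (hp m hm i)).1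
        have h2 := hsmall i
        have h3 := hzero i (p m) hi
        linarith
    have := hA 0 p N hmem fun m hm => by linarith [hstep m hm]
    linarith

/-- A two-sided series dominated by geometric sequences increasing up to the index `k` and
decreasing from there on is summable and close to its `k`-th term. -/
theorem summable_and_abs_tsum_sub_le {a : ℤ → ℝ} {q μ d : ℝ} (hq : 1 < q) (hμ0 : 0 < μ)
    (hμ1 : μ < 1) (haq : ∀ j, |a j| ≤ q ^ j) (haμ : ∀ j, |a j| ≤ μ ^ j * d) (k : ℤ) :
    Summable a ∧ |∑' j, a j - a k| ≤ q ^ k * (1 / (q - 1)) + μ ^ k * d * (μ / (1 - μ)) := by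
  have hq0 : 0 < q := by linarith
  let b : ℤ → ℝ := fun j => a (k + j)
  have hup : HasSum (fun m : ℕ => μ ^ k * d * μ * μ ^ m) (μ ^ k * d * (μ / (1 - μ))) := by
    have := (hasSum_geometric_of_lt_one hμ0.le hμ1).mul_left (μ ^ k * d * μ)
    rwa [mul_assoc _ μ, ← div_eq_mul_inv] at this
  have hdn : HasSum (fun m : ℕ => q ^ k * q⁻¹ * q⁻¹ ^ m) (q ^ k * (1 / (q - 1))) := by
    have := (hasSum_geometric_of_lt_one (inv_nonneg.2 hq0.le)
      (inv_lt_one_of_one_lt₀ hq)).mul_left (q ^ k * q⁻¹)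
    have h1 : q⁻¹ * (1 - q⁻¹)⁻¹ = 1 / (q - 1) := by
      rw [← mul_inv, mul_sub, mul_one, mul_inv_cancel₀ hq0.ne', one_div]
    rwa [mul_assoc, h1] at this
  have hbup : ∀ m : ℕ, ‖b (m + 1)‖ ≤ μ ^ k * d * μ * μ ^ m := fun m => by
    refine (haμ _).trans (le_of_eq ?_)
    rw [zpow_add₀ hμ0.ne', zpow_add₀ hμ0.ne', zpow_natCast, zpow_one]
    ring
  have hbdn : ∀ m : ℕ, ‖b (-(m + 1))‖ ≤ q ^ k * q⁻¹ * q⁻¹ ^ m := fun m => by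
    refine (haq _).trans (le_of_eq ?_)
    rw [zpow_add₀ hq0.ne', zpow_neg, zpow_add₀ hq0.ne', zpow_natCast, zpow_one, inv_pow]
    field_simp
  have hsup : Summable fun m : ℕ => b (m + 1) := .of_norm_bounded hup.summable hbup
  have hsdn : Summable fun m : ℕ => b (-(m + 1)) := .of_norm_bounded hdn.summable hbdn
  have hnat : HasSum (fun m : ℕ => b m) (b 0 + ∑' m : ℕ, b (m + 1)) := by
    have : HasSum (fun m : ℕ => b ((m + 1 : ℕ) : ℤ)) (∑' m : ℕ, b (m + 1)) := by
      simpa using hsup.hasSum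
    simpa [add_comm] using (hasSum_nat_add_iff (f := fun m : ℕ => b m) 1).1 this
  have hb := HasSum.of_nat_of_neg_add_one hnat hsdn.hasSum
  have ha : HasSum a (b 0 + ∑' m : ℕ, b (m + 1) + ∑' m : ℕ, b (-(m + 1))) :=
    (Equiv.addLeft k).hasSum_iff.1 hb
  refine ⟨ha.summable, ?_⟩
  have h1 := tsum_of_norm_bounded hup hbup
  have h2 := tsum_of_norm_bounded hdn hbdn
  have hb0 : b 0 = a k := by simp [b]
  rw [ha.tsum_eq, hb0]
  rw [Real.norm_eq_abs] at h1 h2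
  calc _ = |∑' m : ℕ, b (m + 1) + ∑' m : ℕ, b (-(m + 1))| := by congr 1; ring
    _ ≤ _ := (abs_add_le _ _).trans (by linarith)

/-- The weighted sum of the one-scale maps at the scales `l ^ k`, whose increments are controlled
by those of any single summand. -/
theorem NagataWith.exists_multiscale_map {X : Type*} [PseudoMetricSpace X] {n : ℕ} {c : ℝ}
    (hc : 0 < c) (h : NagataWith X n c) {q l : ℝ} (hq : 1 < q) (hql : q < l) :
    ∃ (h : ℤ → Fin n → X → ℝ) (f : X → EuclideanSpace ℝ (Fin n)),
      (∀ k i x y, |h k i x - h k i y| ≤ 1) ∧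
      (∀ k (p : ℕ → X) (N : ℕ), (∀ m < N, dist (p m) (p (m + 1)) ≤ l ^ k) →
        (∀ m ≤ N, ∀ i, |h k i (p m) - h k i (p 0)| < 1 / 2) →
        dist (p 0) (p N) ≤ (12 * (n + 1) * (c + 1) + 2) * l ^ k) ∧
      ∀ k i x y, |f x i - f y i - q ^ k * (h k i x - h k i y)| ≤
        q ^ k * (1 / (q - 1)) + (q / l) ^ k * dist x y * (q / l / (1 - q / l)) := by
  have hq0 : 0 < q := by linarith
  have hl0 : 0 < l := by linarith
  choose h h0 h1 hlip hpath using fun k : ℤ => h.exists_map_cube hc (σ := l ^ k) (by positivity)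
  have hosc : ∀ k i x y, |h k i x - h k i y| ≤ 1 := fun k i x y =>
    abs_le.2 ⟨by linarith [h0 k i x, h1 k i y], by linarith [h0 k i y, h1 k i x]⟩
  have hsum : ∀ (k : ℤ) i x y, Summable (fun j : ℤ => q ^ j * (h j i x - h j i y)) ∧
      |∑' j : ℤ, q ^ j * (h j i x - h j i y) - q ^ k * (h k i x - h k i y)| ≤
        q ^ k * (1 / (q - 1)) + (q / l) ^ k * dist x y * (q / l / (1 - q / l)) := by
    intro k i x y
    refine summable_and_abs_tsum_sub_le hq (by positivity) ((div_lt_one hl0).2 hql)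
      (fun j => ?_) (fun j => ?_) k
    · rw [abs_mul, abs_of_pos (by positivity : 0 < q ^ j)]
      exact mul_le_of_le_one_right (by positivity) (hosc j i x y)
    · rw [abs_mul, abs_of_pos (by positivity : 0 < q ^ j), div_zpow, div_mul_eq_mul_div,
        mul_div_assoc]
      exact mul_le_mul_of_nonneg_left (hlip j i x y) (by positivity)
  rcases isEmpty_or_nonempty X with hX | ⟨⟨x₀⟩⟩
  · exact ⟨h, fun _ => 0, hosc, hpath, fun _ _ x => hX.elim x⟩
  refine ⟨h, fun x => WithLp.toLp 2 fun i => ∑' j : ℤ, q ^ j * (h j i x - h j i x₀),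
    hosc, hpath, fun k i x y => ?_⟩
  have heq : ∑' j : ℤ, q ^ j * (h j i x - h j i x₀) - ∑' j : ℤ, q ^ j * (h j i y - h j i x₀) =
      ∑' j : ℤ, q ^ j * (h j i x - h j i y) := by
    rw [← (hsum k i x x₀).1.tsum_sub (hsum k i y x₀).1]
    exact tsum_congr fun j => by ring
  simpa only [heq] using (hsum k i x y).2

/-- A ratio of scales so large that both tails of a multiscale series are dominated. -/
theorem exists_scale_ratio {ε : ℝ} (hε0 : 0 < ε) (hε1 : ε < 1) (D : ℝ) (hD : 0 < D) :
    ∃ l : ℝ, 1 < l ^ ε ∧ l ^ ε < l ∧ 1 / (l ^ ε - 1) ≤ 1 / 8 ∧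
      (D + 1) * (l ^ ε / l / (1 - l ^ ε / l)) ≤ 1 / 8 := by
  obtain ⟨l, hl, h1, h2⟩ := ((Filter.eventually_gt_atTop (0 : ℝ)).and
    (((tendsto_rpow_atTop hε0).eventually_ge_atTop 9).and
      ((tendsto_rpow_atTop (sub_pos.2 hε1)).eventually_ge_atTop (8 * (D + 1) + 1)))).exists
  have hl2 : l = l ^ ε * l ^ (1 - ε) := by
    rw [← Real.rpow_add hl]
    simp
  have hle : l ^ ε / l = (l ^ (1 - ε))⁻¹ := by
    rw [Real.rpow_sub hl, Real.rpow_one, inv_div]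
  refine ⟨l, by linarith, ?_, ?_, ?_⟩
  · conv_rhs => rw [hl2]
    exact lt_mul_of_one_lt_right (by linarith) (by linarith)
  · exact one_div_le_one_div_of_le (by norm_num) (by linarith)
  · rw [hle]
    generalize l ^ (1 - ε) = t at h2
    have ht : 0 < t - 1 := by linarith
    have : t⁻¹ / (1 - t⁻¹) = 1 / (t - 1) := by
      have : t ≠ 0 := by linarith
      field_simp
    rw [this, mul_one_div, div_le_div_iff₀ ht (by norm_num)]
    linarith

/-- The snowflake map expressed through the original metric and through finite sequences of
points. -/
theorem NagataWith.exists_map_euclidean (n : ℕ) (c : ℝ) (hc : 0 < c) (ε : ℝ) (hε0 : 0 < ε)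
    (hε1 : ε < 1) :
    ∃ C : ℝ, 0 < C ∧ ∀ (X : Type*) [PseudoMetricSpace X], NagataWith X n c →
      ∃ f : X → EuclideanSpace ℝ (Fin n), (∀ x y, dist (f x) (f y) ≤ C * dist x y ^ ε) ∧
        ∀ r : ℝ, 0 < r → ∀ (p : ℕ → X) (N : ℕ), (∀ m < N, dist (p m) (p (m + 1)) ^ ε ≤ r) →
          (∀ m ≤ N, dist (f (p m)) (f (p 0)) ≤ r) → dist (p 0) (p N) ^ ε ≤ C * r := by
  obtain ⟨D, hDdef⟩ : ∃ D : ℝ, D = 12 * (n + 1) * (c + 1) + 2 := ⟨_, rfl⟩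
  have hD : 0 < D := by rw [hDdef]; positivity
  obtain ⟨l, hq1, hql, hlow, hhigh⟩ := exists_scale_ratio hε0 hε1 D hD
  have hl1 : 1 < l := hq1.trans hql
  have hl0 : 0 < l := by linarith
  have hpow : ∀ k : ℤ, (l ^ k) ^ ε = (l ^ ε) ^ k := fun k => by
    rw [← Real.rpow_intCast, ← Real.rpow_intCast, ← Real.rpow_mul hl0.le,
      ← Real.rpow_mul hl0.le, mul_comm]
  obtain ⟨q, hqdef⟩ : ∃ q : ℝ, q = l ^ ε := ⟨_, rfl⟩
  rw [← hqdef] at hq1 hql hlow hhigh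
  simp only [← hqdef] at hpow
  have hq0 : 0 < q := by linarith
  have hw : 0 < q / l / (1 - q / l) :=
    div_pos (by positivity) (sub_pos.2 ((div_lt_one hl0).2 hql))
  obtain ⟨w, hwdef⟩ : ∃ w : ℝ, w = q / l / (1 - q / l) := ⟨_, rfl⟩
  rw [← hwdef] at hhigh hw
  have hA : 0 < 1 / (q - 1) := one_div_pos.2 (by linarith)
  obtain ⟨L, hL⟩ : ∃ L : ℝ, L = 1 + 1 / (q - 1) + l * w := ⟨_, rfl⟩
  have hL0 : 0 < L := by rw [hL]; positivity
  have hC2 : 0 < D ^ ε * (8 * q) := by positivity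
  refine ⟨n * L + D ^ ε * (8 * q), by positivity, fun X _ hX => ?_⟩
  obtain ⟨h, f, hosc, hpath, hf⟩ := hX.exists_multiscale_map hc hq1 hql
  simp only [← hDdef, ← hwdef, div_zpow] at hpath hf
  refine ⟨f, fun x y => ?_, fun r hr p N hstep himg => ?_⟩
  · have hcoord : ∀ i, |f x i - f y i| ≤ L * dist x y ^ ε := by
      intro i
      rcases eq_or_lt_of_le (dist_nonneg (x := x) (y := y)) with hd | hd
      · rw [← hd, Real.zero_rpow hε0.ne', mul_zero]
        by_contra! hpos
        obtain ⟨k, hk, -⟩ := exists_mem_Ioc_zpow (y := q) (x := |f x i - f y i| / (2 * L))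
          (by positivity) hq1
        have h1 := hf k i x y
        rw [← hd, mul_zero, zero_mul, add_zero] at h1
        have h2 := abs_sub_abs_le_abs_sub (f x i - f y i) (q ^ k * (h k i x - h k i y))
        rw [abs_mul, abs_of_pos (by positivity : 0 < q ^ k)] at h2
        have h3 := mul_le_mul_of_nonneg_left (hosc k i x y) (by positivity : 0 ≤ q ^ k)
        have h4 : q ^ k * (2 * L) < |f x i - f y i| := (lt_div_iff₀ (by positivity)).1 hk
        have h5 : q ^ k * L = q ^ k + q ^ k * (1 / (q - 1)) + q ^ k * (l * w) := by
          rw [hL]; ring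
        have h6 : 0 < q ^ k * L := by positivity
        have h7 : 0 < q ^ k * (l * w) := by positivity
        linarith
      · obtain ⟨k, hk1, hk2⟩ := exists_mem_Ico_zpow hd hl1
        have hqk : q ^ k ≤ dist x y ^ ε := by
          rw [← hpow]
          gcongr
        have h1 := hf k i x y
        have h2 := abs_sub_abs_le_abs_sub (f x i - f y i) (q ^ k * (h k i x - h k i y))
        rw [abs_mul, abs_of_pos (by positivity : 0 < q ^ k)] at h2
        have h3 := mul_le_mul_of_nonneg_left (hosc k i x y) (by positivity : 0 ≤ q ^ k)
        have h4 : q ^ k / l ^ k * dist x y ≤ q ^ k * l := by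
          rw [zpow_add_one₀ hl0.ne'] at hk2
          rw [div_mul_eq_mul_div, div_le_iff₀ (by positivity), mul_assoc]
          gcongr
          linarith
        have h5 : q ^ k / l ^ k * dist x y * w ≤ q ^ k * l * w := by gcongr
        have h6 : q ^ k * L = q ^ k + q ^ k * (1 / (q - 1)) + q ^ k * l * w := by
          rw [hL]; ring
        have h7 : q ^ k * L ≤ dist x y ^ ε * L := by gcongr
        linarith
    obtain ⟨t, ht⟩ : ∃ t : ℝ, t = dist x y ^ ε := ⟨_, rfl⟩
    have ht0 : 0 ≤ t := by rw [ht]; positivity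
    rw [← ht] at hcoord ⊢
    have hdist : dist (f x) (f y) ≤ n * (L * t) := by
      rw [EuclideanSpace.dist_eq]
      refine Real.sqrt_le_iff.2 ⟨by positivity, ?_⟩
      calc ∑ i, dist (f x i) (f y i) ^ 2 ≤ ∑ _i : Fin n, (L * t) ^ 2 :=
            Finset.sum_le_sum fun i _ => by
              rw [Real.dist_eq]
              exact pow_le_pow_left₀ (abs_nonneg _) (hcoord i) 2
        _ = n * (L * t) ^ 2 := by simp
        _ ≤ (n : ℝ) ^ 2 * (L * t) ^ 2 := by
            gcongr
            exact_mod_cast Nat.le_self_pow two_ne_zero n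
        _ = (n * (L * t)) ^ 2 := by ring
    have : 0 ≤ D ^ ε * (8 * q) * t := by positivity
    linarith
  · obtain ⟨k, hk1, hk2⟩ := exists_mem_Ico_zpow (by positivity : 0 < 8 * r) hq1
    have hcoord : ∀ m ≤ N, ∀ i, |f (p m) i - f (p 0) i| ≤ r := fun m hm i => by
      refine le_trans ?_ (himg m hm)
      rw [dist_eq_norm]
      exact PiLp.norm_apply_le (f (p m) - f (p 0)) i
    have hlk : ∀ m < N, dist (p m) (p (m + 1)) ≤ l ^ (k + 1) := fun m hm => by
      refine (Real.rpow_le_rpow_iff dist_nonneg (by positivity) hε0).1 ?_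
      rw [hpow]
      linarith [hstep m hm]
    have hnear : ∀ m ≤ N, dist (p 0) (p m) ≤ (D + 1) * l ^ (k + 1) → ∀ i,
        |h (k + 1) i (p m) - h (k + 1) i (p 0)| < 1 / 2 := by
      intro m hm hd i
      have h1 := hf (k + 1) i (p m) (p 0)
      have h2 := hcoord m hm i
      have h3 : q ^ (k + 1) / l ^ (k + 1) * dist (p m) (p 0) ≤ q ^ (k + 1) * (D + 1) := by
        rw [div_mul_eq_mul_div, div_le_iff₀ (by positivity), mul_assoc, dist_comm]
        gcongr
      have h4 : q ^ (k + 1) / l ^ (k + 1) * dist (p m) (p 0) * w ≤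
          q ^ (k + 1) * ((D + 1) * w) := by
        rw [← mul_assoc]
        gcongr
      have hQ : 0 < q ^ (k + 1) := by positivity
      generalize q ^ (k + 1) = Q at *
      have h5 : Q * (1 / (q - 1)) ≤ Q * (1 / 8) := by gcongr
      have h6 : Q * ((D + 1) * w) ≤ Q * (1 / 8) := by gcongr
      have h7 : Q * |h (k + 1) i (p m) - h (k + 1) i (p 0)| < Q * (1 / 2) := by
        rw [← abs_of_pos hQ, ← abs_mul, abs_of_pos hQ]
        have := abs_sub_abs_le_abs_sub (Q * (h (k + 1) i (p m) - h (k + 1) i (p 0)))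
          (f (p m) i - f (p 0) i)
        rw [abs_sub_comm] at h1
        linarith
      exact lt_of_mul_lt_mul_left h7 hQ.le
    have key : ∀ m ≤ N, dist (p 0) (p m) ≤ D * l ^ (k + 1) := by
      intro m
      induction m using Nat.strong_induction_on with
      | _ m ih =>
        intro hm
        refine hpath (k + 1) p m (fun a ha => hlk a (ha.trans_le hm)) fun a ha => ?_
        refine hnear a (ha.trans hm) ?_
        have hlk0 : 0 < l ^ (k + 1) := by positivity
        cases a with
        | zero =>
          rw [dist_self]
          positivity
        | succ a =>
          have h1 := ih a (by omega) (by omega)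
          have h2 := hlk a (by omega)
          linarith [dist_triangle (p 0) (p a) (p (a + 1))]
    calc dist (p 0) (p N) ^ ε ≤ (D * l ^ (k + 1)) ^ ε := by
          gcongr
          exact key N le_rfl
      _ = D ^ ε * q ^ (k + 1) := by rw [Real.mul_rpow hD.le (by positivity), hpow]
      _ ≤ D ^ ε * (q * (8 * r)) := by
          rw [zpow_add_one₀ hq0.ne', mul_comm _ q]
          gcongr
      _ ≤ (n * L + D ^ ε * (8 * q)) * r := by
          have : 0 ≤ n * L * r := by positivity
          linarith

/-- An `r`-path as a finite sequence of points. -/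
theorem SameRComponent.exists_seq {X : Type*} [PseudoMetricSpace X] {r : ℝ} {S : Set X} {x y : X}
    (h : SameRComponent r S x y) :
    ∃ (p : ℕ → X) (N : ℕ), p 0 = x ∧ p N = y ∧ (∀ m ≤ N, p m ∈ S) ∧
      ∀ m < N, dist (p m) (p (m + 1)) ≤ r := by
  obtain ⟨l, ⟨hmem, hchain⟩, hhead, hlast⟩ := h
  have hne : l ≠ [] := by
    rintro rfl
    simp at hhead
  have hpos := List.length_pos_of_ne_nil hne
  have hget : ∀ m (hm : m < l.length), l.getD m x = l[m] := fun m hm =>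
    List.getD_eq_getElem l x hm
  refine ⟨fun m => l.getD m x, l.length - 1, ?_, ?_, fun m hm => ?_, fun m hm => ?_⟩
  · rw [List.head?_eq_getElem?] at hhead
    simp [List.getD, hhead]
  · rw [List.getLast?_eq_getElem?] at hlast
    simp [List.getD, hlast]
  · beta_reduce
    rw [hget m (by omega)]
    exact hmem _ (List.getElem_mem _)
  · simp only [hget m (by omega), hget (m + 1) (by omega)]
    exact List.isChain_iff_getElem.1 hchain m (by omega)

/-- **Theorem A (main theorem).** If `(X,d)` has Nagata dimension at most `n` with Nagata
constant `c` and `ε ∈ (0,1)`, then there is a Lipschitz light map from the snowflake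
`(X, d^ε)` into `ℝⁿ`, whose Lipschitz light constant depends only on `n`, `ε` and `c`. -/
theorem snowflake_nagata_lipschitzLight (n : ℕ) (c : ℝ) (hc : 0 < c)
    (ε : ℝ) (hε0 : 0 < ε) (hε1 : ε < 1) :
    ∃ C : ℝ, 0 < C ∧
      ∀ (X : Type) (m : MetricSpace X), @NagataWith X m.toPseudoMetricSpace n c →
        ∃ f : X → EuclideanSpace ℝ (Fin n),
          @LipschitzLightWith X (EuclideanSpace ℝ (Fin n))
            (Snowflake m hε0 hε1.le).toPseudoMetricSpace inferInstance C f := by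
  obtain ⟨C, hC, hmap⟩ := NagataWith.exists_map_euclidean.{0} n c hc ε hε0 hε1
  refine ⟨C, hC, fun X m hX => ?_⟩
  obtain ⟨f, hlip, hlight⟩ := hmap X hX
  refine ⟨f, hlip, fun r hr W hW x y hxy => ?_⟩
  obtain ⟨p, N, rfl, rfl, hmem, hstep⟩ := @SameRComponent.exists_seq X
    (Snowflake m hε0 hε1.le).toPseudoMetricSpace r (f ⁻¹' W) x y hxy
  refine hlight r hr p N hstep fun a ha => ?_
  have h := (Metric.edist_le_ediam_of_mem (s := W) (hmem a ha) (hmem 0 (Nat.zero_le _))).trans hW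
  rwa [edist_dist, ENNReal.ofReal_le_ofReal_iff hr.le] at h
end

section
/- Suppose a metric space (X,d) has Nagata dimension n ∈ ℕ∪{0,∞}. Then for each ε ∈ (0,1), the snowflake (X,d^ε) has Lipschitz dimension exactly n; in particular, if one of dim_N(X,d) and dim_L(X,d^ε) is infinite, so is the other. -/
open Metric Set
open scoped ENNReal NNReal

/-- The Lipschitz dimension of a metric space: the least `n` such that there is a
Lipschitz light map `X → ℝⁿ`, and `⊤` if there is none. -/
noncomputable def lipschitzDim (X : Type*) [PseudoMetricSpace X] : ℕ∞ :=
  sInf ((fun n : ℕ => (n : ℕ∞)) ''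
    {n : ℕ | ∃ (C : ℝ), 0 < C ∧ ∃ f : X → EuclideanSpace ℝ (Fin n), LipschitzLightWith C f})

/-- The Nagata dimension of a metric space, as an element of `ℕ∞`. -/
noncomputable def nagataDim (X : Type*) [PseudoMetricSpace X] : ℕ∞ :=
  sInf ((fun n : ℕ => (n : ℕ∞)) '' {n : ℕ | ∃ c : ℝ, 0 < c ∧ NagataWith X n c})

open Relation

theorem Metric.ediam_le_ofReal_iff {X : Type*} [PseudoMetricSpace X] {S : Set X} {r : ℝ}
    (hr : 0 ≤ r) : ediam S ≤ ENNReal.ofReal r ↔ ∀ x ∈ S, ∀ y ∈ S, dist x y ≤ r := by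
  simp only [ediam_le_iff, edist_dist, ENNReal.ofReal_le_ofReal_iff hr]

/-- Points joined by an `r`-path in `S` are related by the reflexive transitive closure of the
relation "both points lie in `S` and are at distance at most `r`". -/
theorem SameRComponent.reflTransGen {X : Type*} [PseudoMetricSpace X] {r : ℝ} {S : Set X}
    {x y : X} (h : SameRComponent r S x y) :
    x ∈ S ∧ ReflTransGen (fun p q => p ∈ S ∧ q ∈ S ∧ dist p q ≤ r) x y := by
  obtain ⟨l, ⟨hS, hl⟩, hx, hy⟩ := h
  induction l generalizing x with
  | nil => simp at hx
  | cons a l ih =>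
    obtain rfl : a = x := by simpa using hx
    refine ⟨hS a (by simp), ?_⟩
    cases l with
    | nil =>
      obtain rfl : a = y := by simpa using hy
      exact .refl
    | cons b l =>
      have hl' := List.isChain_cons_cons.1 hl
      have := ih (x := b) (fun z hz => hS z (by simp_all)) hl'.2 rfl (by simpa using hy)
      exact .head ⟨hS a (by simp), this.1, hl'.1⟩ this.2

theorem SameRComponent.of_reflTransGen {X : Type*} [PseudoMetricSpace X] {r : ℝ} {S : Set X}
    {x y : X} (hx : x ∈ S)
    (h : ReflTransGen (fun p q => p ∈ S ∧ q ∈ S ∧ dist p q ≤ r) x y) :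
    SameRComponent r S x y := by
  induction h using ReflTransGen.head_induction_on with
  | refl => exact ⟨[y], ⟨by simpa using hx, by simp [List.Chain']⟩, rfl, rfl⟩
  | head h _ ih =>
    obtain ⟨l, ⟨hS, hl⟩, hx', hy⟩ := ih h.2.1
    cases l with
    | nil => simp at hx'
    | cons b l =>
      obtain rfl := Option.some.inj hx'
      refine ⟨_ :: b :: l, ⟨?_, List.isChain_cons_cons.2 ⟨h.2.2, hl⟩⟩, rfl, by simpa using hy⟩
      simpa [hx] using hS

/-- Lipschitz light maps in terms of real distances and transitive closures. -/
theorem lipschitzLightWith_iff {X Y : Type*} [PseudoMetricSpace X] [PseudoMetricSpace Y]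
    {C : ℝ} {f : X → Y} : LipschitzLightWith C f ↔
      (∀ x y, dist (f x) (f y) ≤ C * dist x y) ∧
      ∀ r : ℝ, 0 < r → ∀ W : Set Y, (∀ u ∈ W, ∀ v ∈ W, dist u v ≤ r) → ∀ x y, f x ∈ W →
        ReflTransGen (fun p q => f p ∈ W ∧ f q ∈ W ∧ dist p q ≤ r) x y → dist x y ≤ C * r := by
  refine and_congr_right fun _ => forall₃_congr fun r hr W => ?_
  rw [← Metric.ediam_le_ofReal_iff hr.le]
  refine forall_congr' fun _ => forall₂_congr fun x y => ?_
  exact ⟨fun h hx hxy => h (.of_reflTransGen hx hxy),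
    fun h hxy => h hxy.reflTransGen.1 hxy.reflTransGen.2⟩

/-- Bounded coverings of controlled multiplicity in terms of real distances. -/
theorem nagataWith_iff {X : Type*} [PseudoMetricSpace X] {n : ℕ} {c : ℝ} (hc : 0 ≤ c) :
    NagataWith X n c ↔ ∀ s : ℝ, 0 < s → ∃ 𝓑 : Set (Set X), (∀ x, ∃ B ∈ 𝓑, x ∈ B) ∧
      (∀ B ∈ 𝓑, ∀ x ∈ B, ∀ y ∈ B, dist x y ≤ c * s) ∧
      ∀ E : Set X, (∀ x ∈ E, ∀ y ∈ E, dist x y ≤ s) →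
        {B ∈ 𝓑 | (B ∩ E).Nonempty}.encard ≤ (n + 1 : ℕ) := by
  refine forall₂_congr fun s hs => exists_congr fun 𝓑 => ?_
  refine and_congr ?_ (and_congr ?_ ?_)
  · simp [eq_univ_iff_forall]
  · exact forall₂_congr fun B _ => Metric.ediam_le_ofReal_iff (by positivity)
  · exact forall_congr' fun E => imp_congr_left (Metric.ediam_le_ofReal_iff hs.le)

/-- A colouring of `ℝⁿ` by `n + 1` colours whose monochromatic pieces, indexed by integer labels,
are bounded and uniformly separated. -/
theorem exists_separated_coloring (n : ℕ) :
    ∃ (col : (Fin n → ℝ) → Fin (n + 1)) (lab : (Fin n → ℝ) → Fin n → ℤ),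
      (∀ u v, col u = col v → lab u = lab v → ∀ i, |u i - v i| ≤ 1) ∧
      ∀ u v, col u = col v → (∀ i, |u i - v i| ≤ 1 / (n + 1)) → lab u = lab v := by
  have hn : (0 : ℤ) < n + 1 := by positivity
  have hnR : (0 : ℝ) < n + 1 := by positivity
  let M (u : Fin n → ℝ) (i : Fin n) : ℤ := ⌊(n + 1) * u i⌋
  have hcol (u : Fin n → ℝ) : ∃ k : Fin (n + 1), ∀ i, M u i % (n + 1) ≠ k := by
    let φ (i : Fin n) : Fin (n + 1) :=
      ⟨(M u i % (n + 1)).toNat, by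
        have := Int.emod_nonneg (M u i) hn.ne'
        have := Int.emod_lt_of_pos (M u i) hn
        lia⟩
    have hφ : ¬ Function.Surjective φ := fun h => by
      simpa using Fintype.card_le_of_surjective φ h
    simp only [Function.Surjective, not_forall, not_exists] at hφ
    obtain ⟨k, hk⟩ := hφ
    refine ⟨k, fun i hi => hk i (Fin.ext ?_)⟩
    simp [φ, hi]
  choose col hcol using hcol
  have hmod (u i) : 1 ≤ (M u i - (col u : ℕ)) % (n + 1) := by
    by_contra! h
    have h0 := Int.emod_nonneg (M u i - (col u : ℕ)) hn.ne'
    refine hcol u i ?_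
    have hd : ((n : ℤ) + 1) ∣ M u i - (col u : ℕ) := Int.dvd_of_emod_eq_zero (by lia)
    rw [(Int.emod_emod_of_dvd _ dvd_rfl).symm, Int.emod_emod_of_dvd _ dvd_rfl,
      Int.emod_eq_emod_iff_emod_sub_eq_zero.2 (Int.emod_eq_zero_of_dvd hd)]
    exact Int.emod_eq_of_lt (by positivity) (by exact_mod_cast (col u).2)
  have hfl (u : Fin n → ℝ) (i) : (M u i : ℝ) ≤ (n + 1) * u i ∧ (n + 1) * u i < M u i + 1 :=
    ⟨Int.floor_le _, Int.lt_floor_add_one _⟩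
  refine ⟨col, fun u i => (M u i - (col u : ℕ)) / (n + 1), ?_, ?_⟩
  · have key (u v : Fin n → ℝ) (i) (hc : col u = col v)
        (hl : (M u i - (col u : ℕ)) / (n + 1) = (M v i - (col v : ℕ)) / ((n : ℤ) + 1)) :
        u i - v i ≤ 1 := by
      have h1 := Int.mul_ediv_add_emod (M u i - (col u : ℕ)) (n + 1)
      have h2 := Int.mul_ediv_add_emod (M v i - (col v : ℕ)) (n + 1)
      rw [hl] at h1
      rw [hc] at h1
      have h3 := Int.emod_lt_of_pos (M u i - (col v : ℕ)) hn
      have h4 := hmod v i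
      have h5 : M u i + 1 ≤ M v i + (n + 1) := by linarith
      have h6 : (M u i : ℝ) + 1 ≤ M v i + (n + 1) := by exact_mod_cast h5
      have := hfl u i
      have := hfl v i
      by_contra! h
      nlinarith
    intro u v hc hl i
    exact abs_le.2 ⟨by linarith [key v u i hc.symm (congrFun hl.symm i)],
      key u v i hc (congrFun hl i)⟩
  · have key (u v : Fin n → ℝ) (i) (hc : col u = col v) (h : u i - v i ≤ 1 / (n + 1)) :
        (M u i - (col u : ℕ)) / (n + 1) ≤ (M v i - (col v : ℕ)) / ((n : ℤ) + 1) := by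
      by_contra! hl
      have h1 := Int.mul_ediv_add_emod (M u i - (col u : ℕ)) (n + 1)
      have h2 := Int.mul_ediv_add_emod (M v i - (col v : ℕ)) (n + 1)
      have h3 := Int.emod_lt_of_pos (M v i - (col v : ℕ)) hn
      have h4 := hmod u i
      rw [hc] at h1 h4 hl
      have h5 : M v i + 2 ≤ M u i := by nlinarith
      have h6 : (M v i : ℝ) + 2 ≤ M u i := by exact_mod_cast h5
      have := hfl u i
      have := hfl v i
      rw [le_div_iff₀ hnR] at h
      nlinarith
    intro u v hc h
    funext i
    exact le_antisymm (key u v i hc (abs_le.1 (h i)).2)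
      (key v u i hc.symm (by linarith [(abs_le.1 (h i)).1]))

theorem EuclideanSpace.dist_le_card_mul {n : ℕ} {u v : EuclideanSpace ℝ (Fin n)} {M : ℝ}
    (hM : 0 ≤ M) (h : ∀ i, |u i - v i| ≤ M) : dist u v ≤ n * M := by
  rw [EuclideanSpace.dist_eq]
  refine Real.sqrt_le_iff.2 ⟨by positivity, ?_⟩
  calc ∑ i, dist (u i) (v i) ^ 2 ≤ ∑ _i : Fin n, M ^ 2 :=
        Finset.sum_le_sum fun i _ => pow_le_pow_left₀ dist_nonneg (h i) 2
    _ = n * M ^ 2 := by simp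
    _ ≤ (n * M) ^ 2 := by
        rw [mul_pow]
        gcongr
        exact_mod_cast Nat.le_self_pow two_ne_zero n

theorem EuclideanSpace.abs_sub_le_dist {n : ℕ} (u v : EuclideanSpace ℝ (Fin n)) (i : Fin n) :
    |u i - v i| ≤ dist u v := by
  simpa [dist_eq_norm] using PiLp.norm_apply_le (u - v) i

/-- A map into `ℝⁿ` that is Lipschitz light for the snowflaked metric forces the Nagata dimension
to be at most `n`. -/
theorem nagataWith_of_snowflake_light {X : Type*} [PseudoMetricSpace X] {n : ℕ} {ε C : ℝ}
    (hε : 0 < ε) (hC : 0 < C) {f : X → EuclideanSpace ℝ (Fin n)}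
    (hf : ∀ x y, dist (f x) (f y) ≤ C * dist x y ^ ε)
    (hlight : ∀ r : ℝ, 0 < r → ∀ W : Set (EuclideanSpace ℝ (Fin n)),
      (∀ u ∈ W, ∀ v ∈ W, dist u v ≤ r) → ∀ x y, f x ∈ W →
        ReflTransGen (fun p q => f p ∈ W ∧ f q ∈ W ∧ dist p q ^ ε ≤ r) x y →
          dist x y ^ ε ≤ C * r) :
    ∃ c : ℝ, 0 < c ∧ NagataWith X n c := by
  set K : ℝ := n * ((n + 1) * C) + 1 with hK
  have hKpos : 0 < K := by positivity
  refine ⟨(C * K) ^ ε⁻¹, by positivity, (nagataWith_iff (by positivity)).2 fun s hs => ?_⟩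
  obtain ⟨col, lab, hbdd, hsep⟩ := exists_separated_coloring n
  set t : ℝ := s ^ ε
  have ht : 0 < t := by positivity
  set T : ℝ := (n + 1) * C * t with hT
  have hTpos : 0 < T := by positivity
  let g (x : X) : Fin n → ℝ := fun i => f x i / T
  let R (x y : X) : Prop := col (g x) = col (g y) ∧ lab (g x) = lab (g y) ∧ dist x y ^ ε ≤ K * t
  have hRsymm : ∀ x y, R x y → R y x := fun x y h =>
    ⟨h.1.symm, h.2.1.symm, by simpa only [dist_comm] using h.2.2⟩
  have hgdist (x y i) : |g x i - g y i| = |f x i - f y i| / T := by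
    rw [← sub_div, abs_div, abs_of_pos hTpos]
  refine ⟨range fun q : Quot R => {x | Quot.mk R x = q}, fun x => ⟨_, ⟨Quot.mk R x, rfl⟩, rfl⟩,
    ?_, ?_⟩
  · rintro _ ⟨q, rfl⟩ x hx y hy
    have hxy : ReflTransGen R x y := by
      have h : EqvGen R x y := Quot.eqvGen_exact (hx.trans hy.symm)
      clear hx hy
      induction h with
      | rel _ _ h => exact .single h
      | refl => exact .refl
      | symm _ _ _ ih => exact (have : Std.Symm R := ⟨hRsymm⟩; ReflTransGen.stdSymm).symm _ _ ih
      | trans _ _ _ _ _ h1 h2 => exact h1.trans h2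
    let W : Set (EuclideanSpace ℝ (Fin n)) :=
      {u | col (fun i => u i / T) = col (g x) ∧ lab (fun i => u i / T) = lab (g x)}
    have hW : ∀ u ∈ W, ∀ v ∈ W, dist u v ≤ K * t := fun u hu v hv => by
      have := EuclideanSpace.dist_le_card_mul (u := u) (v := v) hTpos.le fun i => by
        have := hbdd _ _ (hu.1.trans hv.1.symm) (hu.2.trans hv.2.symm) i
        rwa [← sub_div, abs_div, abs_of_pos hTpos, div_le_one hTpos] at this
      refine this.trans ?_
      rw [hK, hT]
      nlinarith
    clear hx hy
    have hpath : f y ∈ W ∧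
        ReflTransGen (fun p q => f p ∈ W ∧ f q ∈ W ∧ dist p q ^ ε ≤ K * t) x y := by
      induction hxy with
      | refl => exact ⟨⟨rfl, rfl⟩, .refl⟩
      | @tail b c _ h ih =>
        have hcW : f c ∈ W := ⟨h.1.symm.trans ih.1.1, h.2.1.symm.trans ih.1.2⟩
        exact ⟨hcW, ih.2.tail ⟨ih.1, hcW, h.2.2⟩⟩
    have h := hlight (K * t) (by positivity) W hW x y ⟨rfl, rfl⟩ hpath.2
    rw [← Real.rpow_le_rpow_iff dist_nonneg (by positivity) hε,
      Real.mul_rpow (by positivity) hs.le, Real.rpow_inv_rpow (by positivity) hε.ne']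
    exact h.trans_eq (mul_assoc _ _ _).symm
  · intro E hE
    set S := {B ∈ range fun q : Quot R => {x | Quot.mk R x = q} | (B ∩ E).Nonempty} with hS
    choose p hp using fun B : S => B.2.2
    have hinj : Function.Injective fun B : S => col (g (p B)) := fun B B' hcol => by
      obtain ⟨q, hq⟩ := B.2.1
      obtain ⟨q', hq'⟩ := B'.2.1
      have hpq : Quot.mk R (p B) = q := by simpa [← hq] using (hp B).1
      have hpq' : Quot.mk R (p B') = q' := by simpa [← hq'] using (hp B').1
      have hd : dist (p B) (p B') ^ ε ≤ t :=
        Real.rpow_le_rpow dist_nonneg (hE _ (hp B).2 _ (hp B').2) hε.le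
      have hlab : lab (g (p B)) = lab (g (p B')) := hsep _ _ hcol fun i => by
        rw [hgdist, div_le_div_iff₀ hTpos (by positivity), one_mul]
        have := (EuclideanSpace.abs_sub_le_dist _ _ i).trans (hf (p B) (p B'))
        rw [hT]
        nlinarith [mul_le_mul_of_nonneg_left hd hC.le]
      have hK1 : 1 ≤ K := le_add_of_nonneg_left (by positivity)
      have hR : R (p B) (p B') := ⟨hcol, hlab, by nlinarith⟩
      refine Subtype.ext ?_
      rw [← hq, ← hq', ← hpq, ← hpq', Quot.sound hR]
    calc S.encard ≤ (univ : Set (Fin (n + 1))).encard :=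
          Function.Embedding.encard_le
            ((⟨_, hinj⟩ : S ↪ Fin (n + 1)).trans (Equiv.Set.univ _).symm.toEmbedding)
      _ = (n + 1 : ℕ) := by simp

/-- The members of `𝓑` meeting the closed ball of radius `ρ` about `x`. -/
def membersNear {X : Type*} [PseudoMetricSpace X] (𝓑 : Set (Set X)) (x : X) (ρ : ℝ) :
    Set (Set X) :=
  {B ∈ 𝓑 | (B ∩ closedBall x ρ).Nonempty}

/-- The least radius, truncated at `R`, of a ball about `x` meeting at least `i` members of `𝓑`. -/
noncomputable def meetRadius {X : Type*} [PseudoMetricSpace X] (𝓑 : Set (Set X)) (R : ℝ) (i : ℕ)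
    (x : X) : ℝ :=
  sInf (insert R {ρ | 0 ≤ ρ ∧ (i : ℕ∞) ≤ (membersNear 𝓑 x ρ).encard})

section MeetRadius

variable {X : Type*} [PseudoMetricSpace X] {𝓑 : Set (Set X)} {R : ℝ} {i : ℕ} {x y : X} {ρ : ℝ}

theorem membersNear_subset {σ : ℝ} (h : ρ + dist x y ≤ σ) :
    membersNear 𝓑 x ρ ⊆ membersNear 𝓑 y σ := fun _ hB =>
  ⟨hB.1, hB.2.mono <| inter_subset_inter_right _ <| closedBall_subset_closedBall' h⟩

theorem dist_le_of_mem_membersNear {D : ℝ} {B : Set X}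
    (hB : ∀ u ∈ B, ∀ v ∈ B, dist u v ≤ D) (hx : B ∈ membersNear 𝓑 x ρ)
    (hy : B ∈ membersNear 𝓑 y ρ) : dist x y ≤ D + 2 * ρ := by
  obtain ⟨u, hu, hux⟩ := hx.2
  obtain ⟨v, hv, hvy⟩ := hy.2
  have h1 := dist_triangle4 x u v y
  have h2 := hB u hu v hv
  rw [mem_closedBall'] at hux
  rw [mem_closedBall] at hvy
  linarith

theorem zero_mem_lowerBounds_meetRadius (hR : 0 ≤ R) :
    0 ∈ lowerBounds (insert R {ρ | 0 ≤ ρ ∧ (i : ℕ∞) ≤ (membersNear 𝓑 x ρ).encard}) := by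
  rintro ρ (rfl | hρ)
  exacts [hR, hρ.1]

theorem meetRadius_nonneg (hR : 0 ≤ R) : 0 ≤ meetRadius 𝓑 R i x :=
  le_csInf (insert_nonempty _ _) (zero_mem_lowerBounds_meetRadius hR)

theorem meetRadius_le (hR : 0 ≤ R) : meetRadius 𝓑 R i x ≤ R :=
  csInf_le ⟨0, zero_mem_lowerBounds_meetRadius hR⟩ (mem_insert _ _)

theorem meetRadius_le_of_le_encard (hR : 0 ≤ R) (hρ : 0 ≤ ρ)
    (h : (i : ℕ∞) ≤ (membersNear 𝓑 x ρ).encard) : meetRadius 𝓑 R i x ≤ ρ :=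
  csInf_le ⟨0, zero_mem_lowerBounds_meetRadius hR⟩ (mem_insert_of_mem _ ⟨hρ, h⟩)

theorem le_encard_of_meetRadius_lt (h : meetRadius 𝓑 R i x < ρ) (hρ : ρ ≤ R) :
    (i : ℕ∞) ≤ (membersNear 𝓑 x ρ).encard := by
  obtain ⟨σ, rfl | hσ, hσρ⟩ := exists_lt_of_csInf_lt (insert_nonempty _ _) h
  · exact absurd hσρ hρ.not_gt
  · exact hσ.2.trans (encard_le_encard (membersNear_subset (by simpa using hσρ.le)))

theorem meetRadius_le_add_dist (hR : 0 ≤ R) :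
    meetRadius 𝓑 R i x ≤ meetRadius 𝓑 R i y + dist x y := by
  rw [← sub_le_iff_le_add]
  refine le_csInf (insert_nonempty _ _) ?_
  rintro ρ (rfl | hρ)
  · linarith [meetRadius_le hR (𝓑 := 𝓑) (i := i) (x := x), dist_nonneg (x := x) (y := y)]
  · rw [sub_le_iff_le_add]
    refine meetRadius_le_of_le_encard hR (add_nonneg hρ.1 dist_nonneg) (hρ.2.trans ?_)
    exact encard_le_encard (membersNear_subset (by rw [dist_comm]))

theorem abs_meetRadius_sub_le (hR : 0 ≤ R) :
    |meetRadius 𝓑 R i x - meetRadius 𝓑 R i y| ≤ dist x y := by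
  rw [abs_sub_le_iff]
  constructor
  · linarith [meetRadius_le_add_dist hR (𝓑 := 𝓑) (i := i) (x := x) (y := y)]
  · linarith [meetRadius_le_add_dist hR (𝓑 := 𝓑) (i := i) (x := y) (y := x), dist_comm x y]

theorem meetRadius_one (hR : 0 ≤ R) (hx : ∃ B ∈ 𝓑, x ∈ B) : meetRadius 𝓑 R 1 x = 0 := by
  refine le_antisymm (meetRadius_le_of_le_encard hR le_rfl ?_) (meetRadius_nonneg hR)
  obtain ⟨B, hB, hx⟩ := hx
  rw [Nat.cast_one, one_le_encard_iff_nonempty]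
  exact ⟨B, hB, x, hx, by simp⟩

theorem meetRadius_eq_of_encard_lt (hR : 0 ≤ R)
    (h : (membersNear 𝓑 x R).encard < i) : meetRadius 𝓑 R i x = R := by
  refine le_antisymm (meetRadius_le hR) (le_csInf (insert_nonempty _ _) ?_)
  rintro ρ (rfl | hρ)
  · exact le_rfl
  · by_contra! hlt
    refine absurd h (hρ.2.trans (encard_le_encard (membersNear_subset ?_))).not_gt
    simpa using hlt.le

/-- Across a gap between consecutive meeting radii, the set of nearby members does not change. -/
theorem membersNear_subset_of_gap {α β : ℝ} (hR : 0 ≤ R) (hα : 0 ≤ α)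
    (hi : meetRadius 𝓑 R i y < α) (hi' : β < meetRadius 𝓑 R (i + 1) y) (hd : α + dist x y ≤ β) :
    membersNear 𝓑 x α ⊆ membersNear 𝓑 y α := by
  have hαβ : α ≤ β := by linarith [dist_nonneg (x := x) (y := y)]
  have hβR : β ≤ R := hi'.le.trans (meetRadius_le hR)
  have h1 := le_encard_of_meetRadius_lt hi (hαβ.trans hβR)
  have h2 : (membersNear 𝓑 y β).encard ≤ i := by
    by_contra! h
    refine absurd (meetRadius_le_of_le_encard hR (hα.trans hαβ) ?_) hi'.not_ge
    exact_mod_cast Order.add_one_le_of_lt h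
  have hfin : (membersNear 𝓑 y β).Finite := finite_of_encard_le_coe h2
  rw [hfin.eq_of_subset_of_encard_le' (membersNear_subset (by simpa using hαβ)) (h2.trans h1)]
  exact membersNear_subset hd

end MeetRadius

theorem exists_gap_of_eq_zero {u : ℕ → ℝ} {n : ℕ} {R : ℝ} (h1 : u 1 = 0) (h2 : u (n + 2) = R) :
    ∃ i, 1 ≤ i ∧ i ≤ n + 1 ∧ R / (n + 1) ≤ u (i + 1) - u i := by
  obtain ⟨i, hi, h⟩ := Finset.exists_le_of_sum_le (s := Finset.range (n + 1))
    (f := fun _ => R / (n + 1)) (g := fun i => u (i + 1 + 1) - u (i + 1)) (by simp) (by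
      rw [Finset.sum_range_sub (fun i => u (i + 1))]
      simp only [Finset.sum_const, Finset.card_range, nsmul_eq_mul, h1, h2, zero_add]
      push_cast
      field_simp
      simp)
  exact ⟨i + 1, by lia, by simp at hi; lia, h⟩

theorem hasSum_pow_natAbs {q : ℝ} (h0 : 0 ≤ q) (h1 : q < 1) :
    HasSum (fun k : ℤ => q ^ k.natAbs) (1 + 2 * q / (1 - q)) := by
  have h := hasSum_geometric_of_lt_one h0 h1
  have h' := HasSum.of_nat_of_neg_add_one (f := fun k : ℤ => q ^ k.natAbs)
    (m := (1 - q)⁻¹) (m' := q * (1 - q)⁻¹) (by simpa using h) (by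
      refine (h.mul_left q).congr_fun fun k => ?_
      rw [← pow_succ']
      congr 1)
  convert h' using 1
  have : 1 - q ≠ 0 := by linarith
  field_simp
  ring

/-- Data for summing functions at all scales `l ^ k`, weighted by `(a / l) ^ k`, with geometric
decay `q` away from the dominant scale. -/
structure IsScaleRatio (l a q : ℝ) : Prop where
  one_lt : 1 < l
  pos : 0 < a
  nonneg : 0 ≤ q
  lt_one : q < 1
  inv_le : a⁻¹ ≤ q
  div_le : a / l ≤ q

/-- The weighted sum over all scales of the increments of `g` from `x₀`. -/
noncomputable def scaleSum {X : Type*} (l a : ℝ) (g : ℤ → X → ℝ) (x₀ x : X) : ℝ :=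
  ∑' k : ℤ, (a / l) ^ k * (g k x - g k x₀)

section ScaleSum

variable {X : Type*} [PseudoMetricSpace X] {l a q : ℝ} {g : ℤ → X → ℝ} {x₀ x y : X}
  {D : ℝ} {k : ℤ}

theorem IsScaleRatio.abs_term_le (h : IsScaleRatio l a q)
    (hg : ∀ k x y, |g k x - g k y| ≤ l ^ k) (hg' : ∀ k x y, |g k x - g k y| ≤ dist x y)
    (hD : 1 ≤ D) (hd : dist x y ≤ D * l ^ k) (j : ℤ) :
    |(a / l) ^ j * (g j x - g j y)| ≤ D * a ^ k * q ^ (j - k).natAbs := by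
  have hl : 0 < l := zero_lt_one.trans h.one_lt
  have ha := h.pos
  have hq := h.nonneg
  rw [abs_mul, abs_of_pos (by positivity)]
  rcases le_total j k with hjk | hjk
  · obtain ⟨m, rfl⟩ : ∃ m : ℕ, k = j + m := ⟨(k - j).toNat, by lia⟩
    calc (a / l) ^ j * |g j x - g j y| ≤ (a / l) ^ j * l ^ j := by gcongr; exact hg _ _ _
      _ = 1 * a ^ (j + m : ℤ) * a⁻¹ ^ m := by
        rw [zpow_add₀ ha.ne', div_zpow]
        simp only [zpow_natCast, inv_pow]
        field_simp
      _ ≤ D * a ^ (j + m : ℤ) * q ^ (j - (j + m)).natAbs := by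
        have : (j - (j + m)).natAbs = m := by lia
        rw [this]
        gcongr
        exact h.inv_le
  · obtain ⟨m, rfl⟩ : ∃ m : ℕ, j = k + m := ⟨(j - k).toNat, by lia⟩
    calc (a / l) ^ (k + m : ℤ) * |g (k + m) x - g (k + m) y|
        ≤ (a / l) ^ (k + m : ℤ) * (D * l ^ k) := by gcongr; exact (hg' _ _ _).trans hd
      _ = D * a ^ k * (a / l) ^ m := by
        rw [zpow_add₀ (by positivity), div_zpow]
        simp only [zpow_natCast]
        field_simp
      _ ≤ D * a ^ k * q ^ (k + m - k).natAbs := by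
        have : (k + m - k : ℤ).natAbs = m := by lia
        rw [this]
        gcongr
        exact h.div_le

theorem IsScaleRatio.hasSum_bound (h : IsScaleRatio l a q) (D : ℝ) (k : ℤ) :
    HasSum (fun j : ℤ => D * a ^ k * q ^ (j - k).natAbs)
      (D * a ^ k * (1 + 2 * q / (1 - q))) :=
  (((Equiv.subRight k).hasSum_iff (f := fun j : ℤ => q ^ j.natAbs)).2
    (hasSum_pow_natAbs h.nonneg h.lt_one)).mul_left _

theorem IsScaleRatio.exists_dist_le (h : IsScaleRatio l a q) (x y : X) :
    ∃ k : ℤ, dist x y ≤ 1 * l ^ k := by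
  obtain ⟨m, hm⟩ := pow_unbounded_of_one_lt (dist x y) h.one_lt
  exact ⟨m, by simpa using hm.le⟩

/-- At the scale of `dist x y`, the variation of a multiscale sum is that of its dominant term,
up to a small error. -/
theorem IsScaleRatio.abs_scaleSum_sub_sub_le (h : IsScaleRatio l a q)
    (hg : ∀ k x y, |g k x - g k y| ≤ l ^ k) (hg' : ∀ k x y, |g k x - g k y| ≤ dist x y)
    (hD : 1 ≤ D) (hd : dist x y ≤ D * l ^ k) :
    |scaleSum l a g x₀ x - scaleSum l a g x₀ y - (a / l) ^ k * (g k x - g k y)|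
      ≤ a ^ k * (D * (2 * q / (1 - q))) := by
  have hsum (z : X) : Summable fun k : ℤ => (a / l) ^ k * (g k z - g k x₀) := by
    obtain ⟨k, hk⟩ := h.exists_dist_le z x₀
    exact .of_norm_bounded (h.hasSum_bound 1 k).summable (h.abs_term_le hg hg' le_rfl hk)
  have hdiff : HasSum (fun k : ℤ => (a / l) ^ k * (g k x - g k y))
      (scaleSum l a g x₀ x - scaleSum l a g x₀ y) := by
    refine ((hsum x).hasSum.sub (hsum y).hasSum).congr_fun fun k => ?_
    ring
  have h1 := hasSum_ite_sub_hasSum hdiff k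
  have h2 := hasSum_ite_sub_hasSum (h.hasSum_bound D k) k
  have h3 := tsum_of_norm_bounded h2 (f := fun j => if j = k then 0 else
    (a / l) ^ j * (g j x - g j y)) fun j => by
      split_ifs with hj
      · simp
      · exact h.abs_term_le hg hg' hD hd j
  rw [h1.tsum_eq, Real.norm_eq_abs] at h3
  refine h3.trans_eq ?_
  simp
  ring

end ScaleSum

theorem exists_isScaleRatio {ε q : ℝ} (hε0 : 0 < ε) (hε1 : ε < 1) (hq0 : 0 < q) (hq1 : q < 1) :
    ∃ l : ℝ, IsScaleRatio l (l ^ ε) q := by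
  set μ := min ε (1 - ε)
  have hμ : 0 < μ := lt_min hε0 (by linarith)
  have hl : 1 < q ^ (-μ⁻¹) :=
    Real.one_lt_rpow_of_pos_of_lt_one_of_neg hq0 hq1 (by simpa using hμ)
  have hlq : (q ^ (-μ⁻¹)) ^ (-μ) = q := by
    rw [← Real.rpow_mul hq0.le, neg_mul_neg, inv_mul_cancel₀ hμ.ne', Real.rpow_one]
  refine ⟨q ^ (-μ⁻¹), hl, by positivity, hq0.le, hq1, ?_, ?_⟩
  · rw [← Real.rpow_neg (by positivity)]
    calc _ ≤ (q ^ (-μ⁻¹)) ^ (-μ) := Real.rpow_le_rpow_of_exponent_le hl.le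
          (neg_le_neg (min_le_left _ _))
      _ = q := hlq
  · nth_rw 2 [← Real.rpow_one (q ^ (-μ⁻¹))]
    rw [← Real.rpow_sub (by positivity)]
    calc _ ≤ (q ^ (-μ⁻¹)) ^ (-μ) := Real.rpow_le_rpow_of_exponent_le hl.le
          (by linarith [min_le_right ε (1 - ε)])
      _ = q := hlq

/-- A metric space of Nagata dimension at most `n` admits a map into `ℝⁿ` that is Lipschitz light
for the snowflaked metric. -/
theorem NagataWith.exists_snowflake_light {X : Type*} [MetricSpace X] {n : ℕ} {ε c : ℝ}
    (hε0 : 0 < ε) (hε1 : ε < 1) (hc : 0 < c) (hX : NagataWith X n c) :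
    ∃ C : ℝ, 0 < C ∧ ∃ f : X → EuclideanSpace ℝ (Fin n),
      (∀ x y, dist (f x) (f y) ≤ C * dist x y ^ ε) ∧
      ∀ r : ℝ, 0 < r → ∀ W : Set (EuclideanSpace ℝ (Fin n)),
        (∀ u ∈ W, ∀ v ∈ W, dist u v ≤ r) → ∀ x y, f x ∈ W →
          ReflTransGen (fun p q => f p ∈ W ∧ f q ∈ W ∧ dist p q ^ ε ≤ r) x y →
            dist x y ^ ε ≤ C * r := by
  rcases isEmpty_or_nonempty X with hempty | ⟨⟨x₀⟩⟩
  · exact ⟨1, one_pos, fun _ => 0, fun x => hempty.elim x, fun _ _ _ _ x => hempty.elim x⟩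
  set η : ℝ := 1 / (16 * (n + 1)) with hη
  have hη0 : 0 < η := by positivity
  have hη1 : η ≤ 1 := by
    rw [hη, div_le_one (by positivity)]
    linarith [(n.cast_nonneg : (0 : ℝ) ≤ n)]
  set D : ℝ := c + 2 with hD
  have hD1 : 1 ≤ D := by linarith
  obtain ⟨l, hl⟩ := exists_isScaleRatio (q := η / (2 * D + η)) hε0 hε1 (by positivity)
    (by rw [div_lt_one (by positivity)]; linarith)
  have hl1 := hl.one_lt
  have hl0 : 0 < l := zero_lt_one.trans hl1
  set a : ℝ := l ^ ε with ha
  have ha1 : 1 < a := Real.one_lt_rpow hl1 hε0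
  have ha0 : 0 < a := hl.pos
  have hpow (k : ℤ) : (l ^ k) ^ ε = a ^ k := by
    rw [ha, ← Real.rpow_intCast, ← Real.rpow_intCast, ← Real.rpow_mul hl0.le,
      ← Real.rpow_mul hl0.le, mul_comm]
  choose 𝓑 hcov hdiam hmult using fun k : ℤ =>
    (nagataWith_iff hc.le).1 hX (l ^ k) (zpow_pos hl0 k)
  let ρ (i : ℕ) (k : ℤ) (x : X) : ℝ := meetRadius (𝓑 k) (l ^ k / 2) i x
  have hR (k : ℤ) : 0 ≤ l ^ k / 2 := by positivity
  have hρ (i k x y) : |ρ i k x - ρ i k y| ≤ l ^ k := by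
    have h1 := meetRadius_nonneg (hR k) (𝓑 := 𝓑 k) (i := i) (x := x)
    have h2 := meetRadius_nonneg (hR k) (𝓑 := 𝓑 k) (i := i) (x := y)
    have h3 := meetRadius_le (hR k) (𝓑 := 𝓑 k) (i := i) (x := x)
    have h4 := meetRadius_le (hR k) (𝓑 := 𝓑 k) (i := i) (x := y)
    exact abs_le.2 ⟨by linarith, by linarith⟩
  have hρ' (i k x y) : |ρ i k x - ρ i k y| ≤ dist x y := abs_meetRadius_sub_le (hR k)
  have hρ_one (k x) : ρ 1 k x = 0 := meetRadius_one (hR k) (hcov k x)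
  have hρ_last (k x) : ρ (n + 2) k x = l ^ k / 2 := by
    refine meetRadius_eq_of_encard_lt (hR k) ((hmult k _ fun u hu v hv => ?_).trans_lt ?_)
    · linarith [dist_triangle_right u v x, mem_closedBall.1 hu, mem_closedBall.1 hv]
    · exact_mod_cast Nat.lt_succ_self _
  let G (i : ℕ) : X → ℝ := scaleSum l a (ρ i) x₀
  have hG (i k x y) (h : dist x y ≤ D * l ^ k) :
      |G i x - G i y - (a / l) ^ k * (ρ i k x - ρ i k y)| ≤ a ^ k * η := by
    refine (hl.abs_scaleSum_sub_sub_le (hρ i) (hρ' i) hD1 h).trans_eq ?_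
    congr 1
    have : 2 * D + η ≠ 0 := by positivity
    have : 1 - η / (2 * D + η) = 2 * D / (2 * D + η) := by field_simp; ring
    rw [this]
    field_simp
  let f (x : X) : EuclideanSpace ℝ (Fin n) := WithLp.toLp 2 fun j => G (j + 2) x
  have hf (x y) (j : Fin n) : |G (j + 2) x - G (j + 2) y| ≤ dist (f x) (f y) :=
    EuclideanSpace.abs_sub_le_dist (f x) (f y) j
  refine ⟨n * ((1 + η) * a) + (c + 1) * a / η, by positivity, f, fun x y => ?_, ?_⟩
  · rcases eq_or_ne x y with rfl | hxy
    · simp [Real.zero_rpow hε0.ne']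
    obtain ⟨k, hk, hk'⟩ := exists_mem_Ioc_zpow (dist_pos.2 hxy) hl1
    have hak : a ^ (k + 1) ≤ a * dist x y ^ ε := by
      rw [zpow_add_one₀ ha0.ne', mul_comm, ← hpow]
      gcongr
    have hle : dist (f x) (f y) ≤ n * ((1 + η) * a ^ (k + 1)) := by
      refine EuclideanSpace.dist_le_card_mul (by positivity) fun j => ?_
      have h1 := hG (j + 2) (k + 1) x y (by nlinarith [zpow_pos hl0 (k + 1)])
      have h2 : |(a / l) ^ (k + 1) * (ρ (j + 2) (k + 1) x - ρ (j + 2) (k + 1) y)|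
          ≤ a ^ (k + 1) := by
        rw [abs_mul, abs_of_pos (by positivity), div_zpow, div_mul_eq_mul_div,
          div_le_iff₀ (by positivity)]
        gcongr
        exact hρ _ _ _ _
      have h3 := abs_add_le (G (j + 2) x - G (j + 2) y -
        (a / l) ^ (k + 1) * (ρ (j + 2) (k + 1) x - ρ (j + 2) (k + 1) y))
        ((a / l) ^ (k + 1) * (ρ (j + 2) (k + 1) x - ρ (j + 2) (k + 1) y))
      rw [sub_add_cancel] at h3
      change |G (j + 2) x - G (j + 2) y| ≤ _
      linarith
    have h0 : 0 ≤ (c + 1) * a / η * dist x y ^ ε := by positivity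
    have h1 : n * ((1 + η) * a ^ (k + 1)) ≤ n * ((1 + η) * (a * dist x y ^ ε)) := by gcongr
    linarith
  · intro r hr W hW x y hx hxy
    obtain ⟨m, hm, hm'⟩ := exists_mem_Ioc_zpow (div_pos hr hη0) ha1
    set k := m + 1
    have hak : a ^ k ≤ a * (r / η) := by
      rw [zpow_add_one₀ ha0.ne', mul_comm]
      gcongr
    rw [div_le_iff₀ hη0] at hm'
    have hs : 0 < l ^ k := zpow_pos hl0 k
    have hstep (p p' : X) (h : dist p p' ^ ε ≤ r) : dist p p' ≤ η * l ^ k := by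
      rw [← Real.rpow_le_rpow_iff dist_nonneg (by positivity) hε0,
        Real.mul_rpow hη0.le hs.le, hpow]
      refine (h.trans hm').trans ?_
      rw [mul_comm]
      gcongr
      exact Real.self_le_rpow_of_le_one hη0.le hη1 hε1.le
    have hvar (p i) (hi : 1 ≤ i) (hi' : i ≤ n + 2) (hp : f p ∈ W) (hd : dist p x ≤ D * l ^ k) :
        |ρ i k p - ρ i k x| ≤ 2 * η * l ^ k := by
      rcases eq_or_lt_of_le hi with rfl | hi
      · rw [hρ_one, hρ_one]
        simp
        positivity
      rcases eq_or_lt_of_le hi' with rfl | hi'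
      · rw [hρ_last, hρ_last]
        simp
        positivity
      obtain ⟨j, rfl⟩ := Nat.exists_eq_add_of_le' (show 2 ≤ i from hi)
      have h1 := hG (j + 2) k p x hd
      have h2 := (hf p x ⟨j, by lia⟩).trans (hW _ hp _ hx)
      have h3 := abs_sub_abs_le_abs_sub ((a / l) ^ k * (ρ (j + 2) k p - ρ (j + 2) k x))
        (G (j + 2) p - G (j + 2) x)
      rw [abs_sub_comm] at h1
      have h4 : |(a / l) ^ k * (ρ (j + 2) k p - ρ (j + 2) k x)| ≤ a ^ k * (2 * η) := by
        linarith
      rw [abs_mul, abs_of_pos (by positivity), div_zpow, div_mul_eq_mul_div,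
        div_le_iff₀ hs, mul_assoc] at h4
      exact le_of_mul_le_mul_left h4 (by positivity)
    obtain ⟨i, hi, hi', hgap⟩ := exists_gap_of_eq_zero (u := fun i => ρ i k x) (hρ_one k x)
      (hρ_last k x)
    have hgap' : ρ i k x + 8 * η * l ^ k ≤ ρ (i + 1) k x := by
      have : l ^ k / 2 / (n + 1) = 8 * η * l ^ k := by
        rw [hη]
        field_simp
        norm_num
      linarith
    have hηs : 0 < η * l ^ k := by positivity
    have hρ0 : 0 ≤ ρ i k x := meetRadius_nonneg (hR k)
    have hρR : ρ (i + 1) k x ≤ l ^ k / 2 := meetRadius_le (hR k)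
    set α := ρ i k x + 3 * η * l ^ k
    have hα : 0 ≤ α := by positivity
    obtain ⟨B, hB⟩ : (membersNear (𝓑 k) x α).Nonempty := by
      rw [← one_le_encard_iff_nonempty]
      refine le_trans ?_ (le_encard_of_meetRadius_lt (i := i) (R := l ^ k / 2) ?_ ?_)
      · exact_mod_cast hi
      · change ρ i k x < α
        linarith
      · linarith
    have hdist (p) (hp : B ∈ membersNear (𝓑 k) p α) : dist p x ≤ (c + 1) * l ^ k := by
      have := dist_le_of_mem_membersNear (hdiam k B hB.1) hp hB
      linarith
    have hy : B ∈ membersNear (𝓑 k) y α := by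
      induction hxy with
      | refl => exact hB
      | @tail p p' _ h ih =>
        have hpp' := hstep p p' h.2.2
        have hd : dist p' x ≤ D * l ^ k := by
          have := hdist p ih
          have := dist_triangle_left p' x p
          have : η * l ^ k ≤ 1 * l ^ k := by gcongr
          linarith
        have h1 := abs_le.1 (hvar p' i hi (by lia) h.2.1 hd)
        have h2 := abs_le.1 (hvar p' (i + 1) (by lia) (by lia) h.2.1 hd)
        refine membersNear_subset_of_gap (i := i) (β := α + η * l ^ k) (hR k) hα ?_ ?_ ?_ ih
        · change ρ i k p' < α
          linarith
        · change _ < ρ (i + 1) k p'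
          linarith
        · linarith
    have hc1 : (c + 1) ^ ε ≤ c + 1 := Real.rpow_le_self_of_one_le (by linarith) hε1.le
    calc dist x y ^ ε ≤ ((c + 1) * l ^ k) ^ ε := by
          rw [dist_comm]
          exact Real.rpow_le_rpow dist_nonneg (hdist y hy) hε0.le
      _ = (c + 1) ^ ε * a ^ k := by rw [Real.mul_rpow (by positivity) hs.le, hpow]
      _ ≤ (c + 1) * (a * (r / η)) := by gcongr
      _ = (c + 1) * a / η * r := by ring
      _ ≤ (n * ((1 + η) * a) + (c + 1) * a / η) * r := by
          gcongr
          exact le_add_of_nonneg_left (by positivity)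

/-- If `(X,d)` has Nagata dimension `n ∈ ℕ ∪ {0,∞}`, then for each `ε ∈ (0,1)` the
snowflake `(X, d^ε)` has Lipschitz dimension exactly `n` (in particular one side is
infinite iff the other is). -/
theorem lipschitzDim_snowflake_eq_nagataDim (X : Type*) (m : MetricSpace X)
    (ε : ℝ) (hε0 : 0 < ε) (hε1 : ε < 1) :
    @lipschitzDim X (Snowflake m hε0 hε1.le).toPseudoMetricSpace
      = @nagataDim X m.toPseudoMetricSpace := by
  suffices {n : ℕ | ∃ C : ℝ, 0 < C ∧ ∃ f : X → EuclideanSpace ℝ (Fin n),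
      @LipschitzLightWith X _ (Snowflake m hε0 hε1.le).toPseudoMetricSpace _ C f} =
      {n : ℕ | ∃ c : ℝ, 0 < c ∧ NagataWith X n c} by
    rw [lipschitzDim, nagataDim, this]
  ext n
  simp only [mem_ofPred_eq]
  constructor
  · rintro ⟨C, hC, f, hf⟩
    have h := (@lipschitzLightWith_iff X _ (Snowflake m hε0 hε1.le).toPseudoMetricSpace
      _ C f).1 hf
    exact nagataWith_of_snowflake_light hε0 hC h.1 h.2
  · rintro ⟨c, hc, h⟩
    obtain ⟨C, hC, f, hf⟩ := h.exists_snowflake_light hε0 hε1 hc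
    exact ⟨C, hC, f, (@lipschitzLightWith_iff X _ (Snowflake m hε0 hε1.le).toPseudoMetricSpace
      _ C f).2 hf⟩
end
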